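/- Let N ≥ 1 and n ≥ 1. Every Lagrangian submodule L of (ZMod N)^{2n} with respect to the antidiagonal bilinear form b has cardinality exactly N^n. -/

import Mathlib

/-- The antidiagonal bilinear form on `(ZMod N)^{2n}`:
`b(x,y) = ∑_{i=1}^{2n} x_i y_{2n+1−i}`. -/
def adForm (N n : ℕ) (x y : Fin (2 * n) → ZMod N) : ZMod N :=
  ∑ i, x i * y i.rev

/-- For a left-separating bilinear form on a finite `ZMod N`-module, the cardinalities of a
submodule and of its orthogonal complement multiply to that of the whole module. Both
evaluations of `∑ x ∈ L, ∑ y, ψ (B x y)`, with `ψ` a faithful character of `ZMod N`, are compared. -/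
theorem card_mul_card_orthogonalBilin {N : ℕ} [NeZero N] {M : Type*} [AddCommGroup M]
    [Module (ZMod N) M] [Finite M] {B : M →ₗ[ZMod N] M →ₗ[ZMod N] ZMod N}
    (hB : B.SeparatingLeft) (L : Submodule (ZMod N) M) :
    Nat.card L * Nat.card (L.orthogonalBilin B) = Nat.card M := by
  classical
  have := Fintype.ofFinite M
  obtain ⟨ψ, hψ⟩ : ∃ ψ : AddChar (ZMod N) ℂ, ∀ a, ψ a = 1 ↔ a = 0 := by
    refine ⟨ZMod.stdAddChar, fun a ↦ ?_⟩
    rw [← AddChar.map_zero_eq_one (ZMod.stdAddChar (N := N)), ZMod.injective_stdAddChar.eq_iff]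
  have sum_right (x : L) : ∑ y, ψ (B x y) = if x = 0 then (Nat.card M : ℂ) else 0 := by
    have h := (ψ.compAddMonoidHom (B x).toAddMonoidHom).sum_eq_ite
    have h0 : ψ.compAddMonoidHom (B x).toAddMonoidHom = 0 ↔ x = 0 := by
      refine ⟨fun h ↦ Subtype.ext (hB _ fun y ↦ (hψ _).1 (DFunLike.congr_fun h y)), ?_⟩
      rintro rfl
      ext y
      simp
    simpa [h0] using h
  have sum_left (y : M) :
      ∑ x : L, ψ (B x y) = if y ∈ L.orthogonalBilin B then (Nat.card L : ℂ) else 0 := by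
    let f : L →+ ZMod N := ((B.flip y).comp L.subtype).toAddMonoidHom
    have h := (ψ.compAddMonoidHom f).sum_eq_ite
    have h0 : ψ.compAddMonoidHom f = 0 ↔ y ∈ L.orthogonalBilin B := by
      rw [Submodule.mem_orthogonalBilin_iff]
      refine ⟨fun h x hx ↦ (hψ _).1 (DFunLike.congr_fun h ⟨x, hx⟩), fun h ↦ ?_⟩
      ext x
      exact (hψ _).2 (h x x.2)
    simpa [h0, f] using h
  have key := Finset.sum_comm (s := Finset.univ) (t := Finset.univ)
    (f := fun (x : L) (y : M) ↦ ψ (B x y))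
  simp only [sum_right, sum_left, Finset.sum_ite_eq', Finset.mem_univ, if_true,
    ← Finset.sum_filter, Finset.sum_const, nsmul_eq_mul] at key
  rw [← Fintype.card_subtype, ← Nat.card_eq_fintype_card] at key
  rw [mul_comm]
  exact_mod_cast key.symm

/-- The antidiagonal form `adForm` as a bilinear map. -/
def adBilin (N n : ℕ) : LinearMap.BilinForm (ZMod N) (Fin (2 * n) → ZMod N) :=
  LinearMap.mk₂ (ZMod N) (adForm N n)
    (fun _ _ _ ↦ by simp [adForm, add_mul, Finset.sum_add_distrib])
    (fun _ _ _ ↦ by simp [adForm, mul_assoc, Finset.mul_sum])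
    (fun _ _ _ ↦ by simp [adForm, mul_add, Finset.sum_add_distrib])
    (fun _ _ _ ↦ by simp [adForm, mul_left_comm, Finset.mul_sum])

theorem separatingLeft_flip_adBilin (N n : ℕ) : (adBilin N n).flip.SeparatingLeft := by
  intro y h
  ext i
  have hi : adForm N n (Pi.single i.rev 1) y = 0 := h (Pi.single i.rev 1)
  simpa [adForm, Pi.single_apply] using hi

/-- Every Lagrangian submodule of `(ZMod N)^{2n}` with respect to the antidiagonal
bilinear form has cardinality exactly `N^n`. -/
theorem lagrangian_card (N n : ℕ) (hN : 1 ≤ N) (hn : 1 ≤ n)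
    (L : Submodule (ZMod N) (Fin (2 * n) → ZMod N))
    (hL : ∀ v, v ∈ L ↔ ∀ w ∈ L, adForm N n v w = 0) :
    Nat.card L = N ^ n := by
  have : NeZero N := ⟨by omega⟩
  have hperp : L.orthogonalBilin (adBilin N n).flip = L := by
    ext v
    rw [hL, Submodule.mem_orthogonalBilin_iff]
    rfl
  have key := card_mul_card_orthogonalBilin (separatingLeft_flip_adBilin N n) L
  rw [hperp] at key
  refine Nat.pow_left_injective two_ne_zero ?_
  simpa [sq, mul_comm 2 n, pow_mul] using key
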